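/- Let 𝒳 be a countably infinite measurable space in which all singletons are measurable. Then there exists no exchangeable sequence (X_i)_{i ∈ ℕ} of 𝒳-valued random variables such that almost surely X_i ≠ X_j for all i ≠ j. Here (X_i) is exchangeable if (X_{π(i)})_{i∈ℕ} has the same distribution as (X_i)_{i∈ℕ} for every bijection π : ℕ → ℕ that fixes all but finitely many elements. -/

import Mathlib

open MeasureTheory

/-- An exchangeable sequence is identically distributed. -/
theorem map_eq_map_of_exchangeable {𝒳 Ω : Type*} [MeasurableSpace 𝒳] [MeasurableSpace Ω]
    {P : Measure Ω} {X : ℕ → Ω → 𝒳} (hX : ∀ i, Measurable (X i))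
    (hexch : ∀ π : Equiv.Perm ℕ, ({i | π i ≠ i}).Finite →
      Measure.map (fun ω => fun i : ℕ => X (π i) ω) P
        = Measure.map (fun ω => fun i : ℕ => X i ω) P) (i j : ℕ) :
    Measure.map (X i) P = Measure.map (X j) P := by
  have hfin : ({k | Equiv.swap j i k ≠ k}).Finite :=
    (Set.toFinite {j, i}).subset fun k hk => by
      by_contra h
      simp only [Set.mem_insert_iff, Set.mem_singleton_iff, not_or] at h
      exact hk (Equiv.swap_apply_of_ne_of_ne h.1 h.2)
  have h := congrArg (Measure.map (Function.eval j)) (hexch (Equiv.swap j i) hfin)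
  rw [Measure.map_map (measurable_pi_apply j) (measurable_pi_lambda _ fun k => hX _),
    Measure.map_map (measurable_pi_apply j) (measurable_pi_lambda _ hX)] at h
  simpa [Function.comp_def] using h

/-- In a finite measure space, infinitely many almost everywhere disjoint measurable sets of equal
measure are null. -/
theorem measure_eq_zero_of_pairwise_aedisjoint {Ω ι : Type*} [Infinite ι] [MeasurableSpace Ω]
    {μ : Measure Ω} [IsFiniteMeasure μ] {s : ι → Set Ω} (hs : ∀ i, MeasurableSet (s i))
    (hd : Pairwise fun i j => AEDisjoint μ (s i) (s j)) (heq : ∀ i j, μ (s i) = μ (s j)) (i : ι) :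
    μ (s i) = 0 := by
  by_contra h
  have hle := tsum_measure_le_measure_univ (fun j => (hs j).nullMeasurableSet) hd
  rw [tsum_congr fun j => heq j i, ENNReal.tsum_const_eq_top_of_ne_zero h] at hle
  exact measure_ne_top μ _ (top_le_iff.mp hle)

/-- Over a countably infinite space (with measurable singletons) there exists no
exchangeable sequence that is almost surely injective. -/
theorem no_exchangeable_injective_sequence_on_countable_space
    {𝒳 : Type} [MeasurableSpace 𝒳] [Countable 𝒳] [Infinite 𝒳]
    (hsing : ∀ x : 𝒳, MeasurableSet {x})
    {Ω : Type} [MeasurableSpace Ω] (P : Measure Ω) [IsProbabilityMeasure P]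
    (X : ℕ → Ω → 𝒳) (hX : ∀ i, Measurable (X i))
    -- exchangeability under finite permutations of the index set
    (hexch : ∀ π : Equiv.Perm ℕ, ({i | π i ≠ i}).Finite →
      Measure.map (fun ω => fun i : ℕ => X (π i) ω) P
        = Measure.map (fun ω => fun i : ℕ => X i ω) P)
    -- almost sure injectivity
    (hinj : ∀ᵐ ω ∂P, ∀ i j : ℕ, i ≠ j → X i ω ≠ X j ω) :
    False := by
  have hnull (x : 𝒳) : P (X 0 ⁻¹' {x}) = 0 := by
    refine measure_eq_zero_of_pairwise_aedisjoint (s := fun i => X i ⁻¹' {x})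
      (fun i => hX i (hsing x)) (fun i j hij => ?_) (fun i j => ?_) 0
    · refine measure_mono_null ?_ (ae_iff.mp hinj)
      rintro ω ⟨hi, hj⟩ hω
      exact hω i j hij (hi.trans hj.symm)
    · rw [← Measure.map_apply (hX i) (hsing x), ← Measure.map_apply (hX j) (hsing x),
        map_eq_map_of_exchangeable hX hexch i j]
  have huniv : P (⋃ x, X 0 ⁻¹' {x}) = 0 := measure_iUnion_null hnull
  rw [← Set.preimage_iUnion, Set.iUnion_of_singleton, Set.preimage_univ, measure_univ] at huniv
  exact one_ne_zero huniv
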